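/- arXiv:1912.06855 — 2 statements merged into one kernel-verified Lean document; each statement's English description precedes it below -/
import Mathlib

section
/- For every ε > 0, lim_{r→0⁺} ( Σ_{λ : |r²|λ| − π²/6| > ε} e^{−r|λ|} ) / ( Σ_{λ} e^{−r|λ|} ) = 0; that is, under the canonical measure on partitions with q = e^{−r}, the rescaled size r²|λ| converges in probability to π²/6 as r → 0⁺. -/
/-- An integer partition: a weakly decreasing sequence of nonnegative integers with only
finitely many nonzero terms; `part i` is the `(i+1)`-st part `λ_{i+1}`. -/
structure IntPartition where
  part : ℕ → ℕ
  antitone : Antitone part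
  finite_supp : (Function.support part).Finite

/-- The size `|λ| = Σ_i λ_i` of a partition. -/
noncomputable def IntPartition.size (lam : IntPartition) : ℕ := ∑ᶠ i, lam.part i

open Filter Topology

namespace IntPartition

theorem part_injective : Function.Injective part := by
  rintro ⟨f, _, _⟩ ⟨g, _, _⟩ h
  cases h
  rfl

/-- The partitions with at most `N` nonzero parts. -/
def lengthLE (N : ℕ) : Set IntPartition := {lam | ∀ i, N ≤ i → lam.part i = 0}

theorem lengthLE_mono : Monotone lengthLE := fun _ _ h _ hl i hi => hl i (h.trans hi)

theorem exists_mem_lengthLE (lam : IntPartition) : ∃ N, lam ∈ lengthLE N := by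
  obtain ⟨M, hM⟩ := lam.finite_supp.bddAbove
  refine ⟨M + 1, fun i hi => ?_⟩
  by_contra h
  have := hM (show i ∈ Function.support lam.part from h)
  omega

theorem size_eq_sum_range {lam : IntPartition} {N : ℕ} (h : lam ∈ lengthLE N) :
    lam.size = ∑ i ∈ Finset.range N, lam.part i := by
  refine finsum_eq_sum_of_support_subset _ fun i hi => ?_
  by_contra hN
  exact hi (h i (by simpa using hN))

/-- The partition obtained from `lam` by adding `j` to each of the first `N` parts. -/
def addToFirst (N j : ℕ) (lam : IntPartition) : IntPartition where
  part i := lam.part i + if i < N then j else 0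
  antitone i k hik := by
    have := lam.antitone hik
    dsimp only
    split_ifs <;> omega
  finite_supp := by
    refine (lam.finite_supp.union (Finset.range N).finite_toSet).subset fun i hi => ?_
    by_contra h
    simp only [Set.mem_union, Function.mem_support, Finset.coe_range, Set.mem_Iio, not_or,
      not_not] at h
    simp [h.1, h.2] at hi

/-- The partition obtained from a partition with at most `N + 1` parts by subtracting its
`(N + 1)`-st part from each of the first `N + 1` parts. -/
def subLast (N : ℕ) (lam : IntPartition) (h : lam ∈ lengthLE (N + 1)) : IntPartition where
  part i := lam.part i - lam.part N
  antitone i k hik := Nat.sub_le_sub_right (lam.antitone hik) _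
  finite_supp := by
    refine (Finset.range (N + 1)).finite_toSet.subset fun i hi => ?_
    by_contra hN
    simp only [Finset.coe_range, Set.mem_Iio, not_lt] at hN
    simp [h i hN] at hi

/-- A partition with at most `N + 1` parts is determined by its `(N + 1)`-st part together with
the partition obtained by subtracting that part from all the others. -/
def lengthLESuccEquiv (N : ℕ) : lengthLE N × ℕ ≃ lengthLE (N + 1) where
  toFun p := ⟨addToFirst (N + 1) p.2 p.1, fun i hi => by
    have h := p.1.2 i (by omega)
    simp only [addToFirst, h]
    split_ifs <;> omega⟩
  invFun lam := (⟨subLast N lam lam.2, fun i hi => by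
    simpa [subLast] using Nat.sub_eq_zero_of_le (lam.1.antitone hi)⟩, lam.1.part N)
  left_inv := by
    rintro ⟨⟨lam, h⟩, j⟩
    have hN := h N le_rfl
    refine Prod.ext (Subtype.ext (part_injective (funext fun i => ?_))) ?_
    · simp only [addToFirst, subLast, hN]
      by_cases hi : i < N + 1
      · simp [hi]
      · simp [hi, h i (by omega)]
    · simp [addToFirst, hN]
  right_inv := by
    rintro ⟨lam, h⟩
    refine Subtype.ext (part_injective (funext fun i => ?_))
    simp only [addToFirst, subLast]
    by_cases hi : i < N + 1
    · have := lam.antitone (show i ≤ N by omega)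
      simp only [hi, if_true]
      omega
    · simp [hi, h i (by omega)]

theorem size_lengthLESuccEquiv (N : ℕ) (p : lengthLE N × ℕ) :
    (lengthLESuccEquiv N p : IntPartition).size = (p.1 : IntPartition).size + (N + 1) * p.2 := by
  rw [size_eq_sum_range (lengthLESuccEquiv N p).2,
    size_eq_sum_range (lengthLE_mono (Nat.le_succ N) p.1.2)]
  simp only [lengthLESuccEquiv, addToFirst, Equiv.coe_fn_mk, Finset.sum_add_distrib]
  congr 1
  rw [Finset.sum_congr rfl fun i hi => if_pos (Finset.mem_range.1 hi)]
  simp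

theorem hasSum_pow_size_lengthLE {q : ℝ} (hq0 : 0 ≤ q) (hq1 : q < 1) (N : ℕ) :
    HasSum (fun lam : lengthLE N => q ^ (lam : IntPartition).size)
      (∏ k ∈ Finset.range N, (1 - q ^ (k + 1))⁻¹) := by
  induction N with
  | zero =>
    let z : lengthLE 0 := ⟨⟨0, antitone_const, by simp⟩, fun _ _ => rfl⟩
    have hz : ∀ lam : lengthLE 0, lam = z := fun lam =>
      Subtype.ext (part_injective (funext fun i => lam.2 i (Nat.zero_le i)))
    have hs : (z : IntPartition).size = 0 := size_eq_sum_range z.2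
    convert hasSum_single z fun lam h => absurd (hz lam) h using 1
    simp [hs]
  | succ N ih =>
    have hg : HasSum (fun j : ℕ => (q ^ (N + 1)) ^ j) (1 - q ^ (N + 1))⁻¹ :=
      hasSum_geometric_of_lt_one (by positivity) (pow_lt_one₀ hq0 hq1 (by omega))
    rw [Finset.prod_range_succ, ← (lengthLESuccEquiv N).hasSum_iff]
    refine HasSum.congr_fun (ih.mul hg (ih.summable.mul_of_nonneg hg.summable
      (fun _ => by positivity) fun _ => by positivity)) fun p => ?_
    simp only [Function.comp_apply, size_lengthLESuccEquiv, pow_add, pow_mul]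

/-- Euler's product for the partition generating function, in exponential form. -/
theorem hasSum_pow_size {q L : ℝ} (hq0 : 0 ≤ q) (hq1 : q < 1)
    (hL : HasSum (fun k : ℕ => -Real.log (1 - q ^ (k + 1))) L) :
    HasSum (fun lam : IntPartition => q ^ lam.size) (Real.exp L) := by
  have hlt : ∀ k : ℕ, 0 < 1 - q ^ (k + 1) := fun k =>
    sub_pos.2 (pow_lt_one₀ hq0 hq1 (by omega))
  have hprod : ∀ N, ∏ k ∈ Finset.range N, (1 - q ^ (k + 1))⁻¹ =
      Real.exp (∑ k ∈ Finset.range N, -Real.log (1 - q ^ (k + 1))) := fun N => by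
    rw [Real.exp_sum]
    exact Finset.prod_congr rfl fun k _ => by rw [Real.exp_neg, Real.exp_log (hlt k)]
  have hnn : ∀ k : ℕ, 0 ≤ -Real.log (1 - q ^ (k + 1)) := fun k =>
    neg_nonneg.2 (Real.log_nonpos (hlt k).le (sub_le_self _ (by positivity)))
  refine hasSum_of_isLUB_of_nonneg _ (fun _ => by positivity) ⟨?_, fun b hb => ?_⟩
  · classical
    rintro _ ⟨s, rfl⟩
    choose n hn using exists_mem_lengthLE
    have hs : ∀ lam ∈ s, lam ∈ lengthLE (s.sup n) := fun lam hl =>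
      lengthLE_mono (Finset.le_sup hl) (hn lam)
    have h := sum_le_hasSum (s.subtype (· ∈ lengthLE (s.sup n))) (fun _ _ => by positivity)
      (hasSum_pow_size_lengthLE hq0 hq1 (s.sup n))
    dsimp only
    rw [Finset.sum_subtype_of_mem (fun lam => q ^ lam.size) hs, hprod] at h
    exact h.trans (Real.exp_le_exp.2 (sum_le_hasSum _ (fun k _ => hnn k) hL))
  · refine le_of_tendsto ((Real.continuous_exp.tendsto L).comp hL.tendsto_sum_nat)
      (Eventually.of_forall fun N => ?_)
    rw [Function.comp_apply, ← hprod]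
    refine hasSum_le_of_sum_le (hasSum_pow_size_lengthLE hq0 hq1 N) fun s => ?_
    refine le_trans (le_of_eq ?_) (hb ⟨s.map (Function.Embedding.subtype _), rfl⟩)
    simp

end IntPartition

theorem inv_exp_sub_one_le {y : ℝ} (hy : 0 < y) : (Real.exp y - 1)⁻¹ ≤ y⁻¹ :=
  inv_anti₀ hy (by linarith [Real.add_one_le_exp y])

/-- The logarithm of the partition function at `q = exp (-r)`, as a Lambert series. -/
noncomputable def logPartitionFunction (r : ℝ) : ℝ :=
  ∑' m : ℕ, ((m : ℝ) + 1)⁻¹ * (Real.exp (r * (m + 1)) - 1)⁻¹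

theorem summable_inv_add_one_sq : Summable fun m : ℕ => (((m : ℝ) + 1) ^ 2)⁻¹ := by
  simpa using (summable_nat_add_iff 1).2 hasSum_zeta_two.summable

theorem tsum_inv_add_one_sq : ∑' m : ℕ, (((m : ℝ) + 1) ^ 2)⁻¹ = Real.pi ^ 2 / 6 := by
  have h := (hasSum_nat_add_iff' 1).2 hasSum_zeta_two
  simpa using h.tsum_eq

theorem mul_logPartitionFunction_term_le {r : ℝ} (hr : 0 < r) (m : ℕ) :
    r * (((m : ℝ) + 1)⁻¹ * (Real.exp (r * (m + 1)) - 1)⁻¹) ≤ (((m : ℝ) + 1) ^ 2)⁻¹ := by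
  have h := inv_exp_sub_one_le (show 0 < r * ((m : ℝ) + 1) by positivity)
  calc r * (((m : ℝ) + 1)⁻¹ * (Real.exp (r * (m + 1)) - 1)⁻¹)
      ≤ r * (((m : ℝ) + 1)⁻¹ * (r * (m + 1))⁻¹) := by gcongr
    _ = (((m : ℝ) + 1) ^ 2)⁻¹ := by field_simp

theorem logPartitionFunction_term_nonneg {r : ℝ} (hr : 0 < r) (m : ℕ) :
    0 ≤ ((m : ℝ) + 1)⁻¹ * (Real.exp (r * (m + 1)) - 1)⁻¹ := by
  have : 1 ≤ Real.exp (r * (m + 1)) := Real.one_le_exp (by positivity)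
  exact mul_nonneg (by positivity) (inv_nonneg.2 (by linarith))

theorem summable_logPartitionFunction {r : ℝ} (hr : 0 < r) :
    Summable fun m : ℕ => ((m : ℝ) + 1)⁻¹ * (Real.exp (r * (m + 1)) - 1)⁻¹ := by
  refine (summable_mul_left_iff hr.ne').1 (Summable.of_nonneg_of_le
    (fun m => mul_nonneg hr.le (logPartitionFunction_term_nonneg hr m))
    (mul_logPartitionFunction_term_le hr) summable_inv_add_one_sq)

/-- Interchange of summation: the column sums of a summable double series add up to the sum of
the row sums. -/
theorem HasSum.of_summable_fiberwise {β γ : Type*} {F : β × γ → ℝ} {f : β → ℝ} {g : γ → ℝ}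
    (hF : Summable F) (hrow : ∀ b, HasSum (fun c => F (b, c)) (f b))
    (hcol : ∀ c, HasSum (fun b => F (b, c)) (g c)) : HasSum g (∑' b, f b) := by
  rw [(hF.hasSum.prod_fiberwise hrow).tsum_eq]
  exact ((Equiv.prodComm γ β).hasSum_iff.2 hF.hasSum).prod_fiberwise hcol

theorem hasSum_exp_pow_div {r : ℝ} (hr : 0 < r) (m : ℕ) :
    HasSum (fun k : ℕ => (Real.exp (-r) ^ (k + 1)) ^ (m + 1) / ((m : ℝ) + 1))
      (((m : ℝ) + 1)⁻¹ * (Real.exp (r * (m + 1)) - 1)⁻¹) := by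
  have hx : Real.exp (-r) ^ (m + 1) = (Real.exp (r * (m + 1)))⁻¹ := by
    rw [← Real.exp_nat_mul, ← Real.exp_neg]
    congr 1
    push_cast
    ring
  have hlt : Real.exp (-r) ^ (m + 1) < 1 :=
    pow_lt_one₀ (Real.exp_pos _).le (Real.exp_lt_one_iff.2 (by linarith)) (by omega)
  have hval : ((m : ℝ) + 1)⁻¹ * (Real.exp (r * (m + 1)) - 1)⁻¹ =
      ((m : ℝ) + 1)⁻¹ * Real.exp (-r) ^ (m + 1) * (1 - Real.exp (-r) ^ (m + 1))⁻¹ := by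
    rw [mul_assoc, hx, ← mul_inv (Real.exp _), mul_one_sub, mul_inv_cancel₀ (by positivity)]
  rw [hval]
  refine HasSum.congr_fun ((hasSum_geometric_of_lt_one (by positivity) hlt).mul_left
    (((m : ℝ) + 1)⁻¹ * Real.exp (-r) ^ (m + 1))) fun k => ?_
  rw [← pow_mul, ← pow_mul]
  ring

theorem hasSum_neg_log_one_sub_exp {r : ℝ} (hr : 0 < r) :
    HasSum (fun k : ℕ => -Real.log (1 - Real.exp (-r) ^ (k + 1))) (logPartitionFunction r) := by
  have hF : Summable fun p : ℕ × ℕ =>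
      (Real.exp (-r) ^ (p.2 + 1)) ^ (p.1 + 1) / ((p.1 : ℝ) + 1) := by
    refine (summable_prod_of_nonneg fun p => by positivity).2
      ⟨fun m => (hasSum_exp_pow_div hr m).summable, ?_⟩
    simpa only [(hasSum_exp_pow_div hr _).tsum_eq] using summable_logPartitionFunction hr
  have hcol : ∀ k : ℕ,
      HasSum (fun m : ℕ => (Real.exp (-r) ^ (k + 1)) ^ (m + 1) / ((m : ℝ) + 1))
        (-Real.log (1 - Real.exp (-r) ^ (k + 1))) := fun k => by
    refine Real.hasSum_pow_div_log_of_abs_lt_one ?_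
    rw [abs_of_pos (by positivity)]
    exact pow_lt_one₀ (Real.exp_pos _).le (Real.exp_lt_one_iff.2 (by linarith)) (by omega)
  rw [logPartitionFunction]
  exact HasSum.of_summable_fiberwise hF (hasSum_exp_pow_div hr) hcol

theorem tendsto_mul_logPartitionFunction :
    Tendsto (fun r => r * logPartitionFunction r) (𝓝[>] 0) (𝓝 (Real.pi ^ 2 / 6)) := by
  simp_rw [logPartitionFunction, ← tsum_mul_left, ← tsum_inv_add_one_sq]
  refine tendsto_tsum_of_dominated_convergence summable_inv_add_one_sq (fun m => ?_) ?_
  · have hd : HasDerivAt (fun r : ℝ => Real.exp (r * (m + 1))) ((m : ℝ) + 1) 0 := by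
      simpa using ((hasDerivAt_id (0 : ℝ)).mul_const ((m : ℝ) + 1)).exp
    have h := (hd.tendsto_slope_zero_right.inv₀ (by positivity)).const_mul ((m : ℝ) + 1)⁻¹
    convert h using 2 with r
    · simp only [zero_add, zero_mul, Real.exp_zero, smul_eq_mul, mul_inv, inv_inv]
      ring
    · rw [sq, mul_inv]
  · filter_upwards [self_mem_nhdsWithin] with r hr m
    rw [Real.norm_of_nonneg (mul_nonneg (le_of_lt hr) (logPartitionFunction_term_nonneg hr m))]
    exact mul_logPartitionFunction_term_le hr m

theorem IntPartition.hasSum_exp_neg_mul_size {r : ℝ} (hr : 0 < r) :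
    HasSum (fun lam : IntPartition => Real.exp (-r * (lam.size : ℝ)))
      (Real.exp (logPartitionFunction r)) := by
  have h := hasSum_pow_size (Real.exp_pos (-r)).le (Real.exp_lt_one_iff.2 (by linarith))
    (hasSum_neg_log_one_sub_exp hr)
  simpa only [← Real.exp_nat_mul, mul_comm] using h

/-- The exponential (Chernoff) tail estimates tend to zero. -/
theorem tendsto_chernoff_bound {s d : ℝ} (hs : 0 < s)
    (hneg : Real.pi ^ 2 / 6 / s - Real.pi ^ 2 / 6 - (1 - s) * d < 0) :
    Tendsto (fun r => Real.exp (logPartitionFunction (s * r) - logPartitionFunction r -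
      (1 - s) * d / r)) (𝓝[>] 0) (𝓝 0) := by
  refine Real.tendsto_exp_atBot.comp ?_
  have hmul : Tendsto (fun r : ℝ => s * r) (𝓝[>] 0) (𝓝[>] 0) := by
    refine tendsto_nhdsWithin_iff.2 ⟨?_, ?_⟩
    · exact (tendsto_nhdsWithin_of_tendsto_nhds (by
        simpa using (continuous_const_mul s).tendsto (0 : ℝ)))
    · filter_upwards [self_mem_nhdsWithin] with r hr using mul_pos hs hr
  have hlim := (((tendsto_mul_logPartitionFunction.comp hmul).div_const s).sub
    tendsto_mul_logPartitionFunction).sub_const ((1 - s) * d)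
  refine (hlim.neg_mul_atTop hneg tendsto_inv_nhdsGT_zero).congr' ?_
  filter_upwards [self_mem_nhdsWithin] with r hr
  have : r ≠ 0 := ne_of_gt hr
  simp only [Function.comp_apply]
  field_simp

theorem exp_neg_mul_le_of_mul_le {r s d n : ℝ} (hr : 0 < r)
    (h : (1 - s) * d ≤ (1 - s) * (r ^ 2 * n)) :
    Real.exp (-r * n) ≤ Real.exp (-(s * r) * n) * Real.exp (-((1 - s) * d / r)) := by
  rw [← Real.exp_add, Real.exp_le_exp]
  have : (1 - s) * d / r ≤ (1 - s) * (r * n) := by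
    rw [div_le_iff₀ hr]
    linarith
  linarith

theorem exists_mul_lt_mul_one_sub {c ε : ℝ} (hc : 0 < c) (hε : 0 < ε) :
    ∃ a : ℝ, 0 < a ∧ a < 1 ∧ a * c < ε * (1 - a) := by
  refine ⟨ε / (2 * c + ε), by positivity, (div_lt_one (by positivity)).2 (by linarith), ?_⟩
  have : 1 - ε / (2 * c + ε) = 2 * c / (2 * c + ε) := by
    field_simp
    ring
  rw [this, div_mul_eq_mul_div, mul_div_assoc']
  exact div_lt_div_of_pos_right (by nlinarith [mul_pos hε hc]) (by positivity)

open scoped Classical in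
theorem canonical_size_concentration (ε : ℝ) (hε : 0 < ε) :
    Filter.Tendsto (fun r : ℝ =>
        (∑' lam : IntPartition,
            if ε < |r ^ 2 * (lam.size : ℝ) - Real.pi ^ 2 / 6| then
              Real.exp (-r * (lam.size : ℝ))
            else 0) /
          (∑' lam : IntPartition, Real.exp (-r * (lam.size : ℝ))))
      (nhdsWithin 0 (Set.Ioi 0)) (nhds 0) := by
  set c : ℝ := Real.pi ^ 2 / 6 with hc
  have hc0 : 0 < c := by positivity
  obtain ⟨a, ha0, ha1, hac⟩ := exists_mul_lt_mul_one_sub hc0 hε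
  have hupper : c / (1 - a) - c - (1 - (1 - a)) * (c + ε) < 0 := by
    have h1a : 0 < 1 - a := by linarith
    have : c / (1 - a) - c - (1 - (1 - a)) * (c + ε) = a * (a * c - ε * (1 - a)) / (1 - a) := by
      field_simp
      ring
    rw [this]
    exact div_neg_of_neg_of_pos (mul_neg_of_pos_of_neg ha0 (by linarith)) h1a
  have hlower : c / (1 + a) - c - (1 - (1 + a)) * (c - ε) < 0 := by
    have : c / (1 + a) - c - (1 - (1 + a)) * (c - ε) = a * (a * c - ε * (1 + a)) / (1 + a) := by
      field_simp
      ring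
    rw [this]
    exact div_neg_of_neg_of_pos (mul_neg_of_pos_of_neg ha0 (by nlinarith)) (by linarith)
  have hbound := (tendsto_chernoff_bound (by linarith) hupper).add
    (tendsto_chernoff_bound (by linarith) hlower)
  rw [add_zero] at hbound
  refine squeeze_zero' (Eventually.of_forall fun r => ?_) ?_ hbound
  · exact div_nonneg (tsum_nonneg fun _ => by split_ifs <;> positivity)
      (tsum_nonneg fun _ => by positivity)
  · filter_upwards [self_mem_nhdsWithin] with r (hr : 0 < r)
    have hZ := IntPartition.hasSum_exp_neg_mul_size hr
    have hdom :=
      ((IntPartition.hasSum_exp_neg_mul_size (mul_pos (show 0 < 1 - a by linarith) hr)).mul_right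
        (Real.exp (-((1 - (1 - a)) * (c + ε) / r)))).add
      ((IntPartition.hasSum_exp_neg_mul_size (mul_pos (show 0 < 1 + a by linarith) hr)).mul_right
        (Real.exp (-((1 - (1 + a)) * (c - ε) / r))))
    have hle : ∀ lam : IntPartition,
        (if ε < |r ^ 2 * (lam.size : ℝ) - c| then Real.exp (-r * (lam.size : ℝ)) else 0) ≤
          Real.exp (-((1 - a) * r) * lam.size) * Real.exp (-((1 - (1 - a)) * (c + ε) / r)) +
          Real.exp (-((1 + a) * r) * lam.size) * Real.exp (-((1 - (1 + a)) * (c - ε) / r)) := by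
      intro lam
      split_ifs with h
      · rcases lt_abs.1 h with h | h
        · exact (exp_neg_mul_le_of_mul_le hr (by nlinarith)).trans
            (le_add_of_nonneg_right (by positivity))
        · exact (exp_neg_mul_le_of_mul_le hr (by nlinarith)).trans
            (le_add_of_nonneg_left (by positivity))
      · positivity
    have hsum := Summable.of_nonneg_of_le (fun _ => by split_ifs <;> positivity) hle hdom.summable
    rw [hZ.tsum_eq, div_le_iff₀ (Real.exp_pos _)]
    refine (hasSum_le hle hsum.hasSum hdom).trans (le_of_eq ?_)
    rw [add_mul (Real.exp _)]
    simp only [← Real.exp_add]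
    congr 2 <;> ring
end

section
/- Let v : ℤ → ℝ satisfy 0 ≤ v_X < 1 for all X and v_X = 0 for all but finitely many X. Then Σ over all sequences (λ(X))_{X∈ℤ} of partitions, with λ(X) the empty partition for all but finitely many X and satisfying, for every k ∈ ℤ, λ(4k) ≺ λ(4k+1), λ(4k+1) ≺′ λ(4k+2), λ(4k+3) ≺ λ(4k+2), λ(4k+4) ≺′ λ(4k+3), of the weight ∏_{X∈ℤ} v_X^{| |λ(X+1)| − |λ(X)| |}, is finite and equals ∏_{(i,j)∈ℤ², i<j} (1 + v_{4i} v_{4j−1})(1 + v_{4i+1} v_{4j−2}) / ( (1 − v_{4i} v_{4j−2})(1 − v_{4i+1} v_{4j−1}) ), where all but finitely many factors of the product equal 1. -/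
/-- `μ ≺ λ`: `λ/μ` is a horizontal strip, i.e. `λ_{i+1} ≤ μ_i ≤ λ_i` for all `i ≥ 1`. -/
def HStrip (mu lam : IntPartition) : Prop :=
  ∀ i : ℕ, lam.part (i + 1) ≤ mu.part i ∧ mu.part i ≤ lam.part i

/-- `μ ≺′ λ`: `λ/μ` is a vertical strip, i.e. `0 ≤ λ_i − μ_i ≤ 1` for all `i ≥ 1`. -/
def VStrip (mu lam : IntPartition) : Prop :=
  ∀ i : ℕ, mu.part i ≤ lam.part i ∧ lam.part i ≤ mu.part i + 1

/-- The empty partition. -/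
def emptyPartition : IntPartition :=
  ⟨fun _ => 0, fun _ _ _ => le_rfl, by simp⟩

/-- A configuration of the (pure) Schur process associated with steep tilings:
a sequence of partitions indexed by `ℤ`, equal to the empty partition for all but
finitely many indices, and satisfying the interlacing pattern
`λ(4k) ≺ λ(4k+1) ≺′ λ(4k+2) ≻ λ(4k+3) ≻′ λ(4k+4)`. -/
structure SchurSeq where
  lam : ℤ → IntPartition
  finite : {X : ℤ | lam X ≠ emptyPartition}.Finite
  inter : ∀ k : ℤ,
    HStrip (lam (4 * k)) (lam (4 * k + 1)) ∧
    VStrip (lam (4 * k + 1)) (lam (4 * k + 2)) ∧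
    HStrip (lam (4 * k + 3)) (lam (4 * k + 2)) ∧
    VStrip (lam (4 * k + 4)) (lam (4 * k + 3))

/-- The weight `∏_{X ∈ ℤ} v_X^{| |λ(X+1)| − |λ(X)| |}` of a configuration. -/
noncomputable def steepWeight (v : ℤ → ℝ) (σ : SchurSeq) : ℝ :=
  ∏ᶠ X : ℤ, v X ^ ((((σ.lam (X + 1)).size : ℤ) - ((σ.lam X).size : ℤ)).natAbs)

open scoped ENNReal

theorem IntPartition.ext_part {lam mu : IntPartition} (h : ∀ i, lam.part i = mu.part i) :
    lam = mu := by
  cases lam; cases mu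
  congr
  exact funext h

theorem IntPartition.exists_bound (lam : IntPartition) : ∃ N, ∀ i, N ≤ i → lam.part i = 0 := by
  obtain ⟨N, hN⟩ := lam.finite_supp.bddAbove
  refine ⟨N + 1, fun i hi => ?_⟩
  by_contra h
  have := hN (show i ∈ Function.support lam.part from h)
  omega

theorem IntPartition.size_eq_sum {lam : IntPartition} {N : ℕ} (h : ∀ i, N ≤ i → lam.part i = 0) :
    lam.size = ∑ i ∈ Finset.range N, lam.part i := by
  refine finsum_eq_sum_of_support_subset _ fun i hi => ?_
  by_contra h'
  exact hi (h i (by simpa using h'))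

theorem IntPartition.size_sub_eq_sum {lam mu : IntPartition} {N : ℕ}
    (hl : ∀ i, N ≤ i → lam.part i = 0) (h : ∀ i, mu.part i ≤ lam.part i) :
    lam.size - mu.size = ∑ i ∈ Finset.range N, (lam.part i - mu.part i) := by
  rw [size_eq_sum hl, size_eq_sum (lam := mu) (N := N) fun i hi => by
    have := h i; have := hl i hi; omega, Finset.sum_tsub_distrib _ fun i _ => h i]

theorem IntPartition.size_le {lam mu : IntPartition} (h : ∀ i, mu.part i ≤ lam.part i) :
    mu.size ≤ lam.size := by
  obtain ⟨N, hN⟩ := lam.exists_bound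
  rw [size_eq_sum hN, size_eq_sum (lam := mu) (N := N) fun i hi => by
    have := h i; have := hN i hi; omega]
  exact Finset.sum_le_sum fun i _ => h i

theorem IntPartition.eq_of_size_le {lam mu : IntPartition} (h : ∀ i, mu.part i ≤ lam.part i)
    (hs : lam.size ≤ mu.size) : mu = lam := by
  obtain ⟨N, hN⟩ := lam.exists_bound
  have key := size_sub_eq_sum hN h
  rw [Nat.sub_eq_zero_of_le hs, eq_comm, Finset.sum_eq_zero_iff] at key
  refine ext_part fun i => ?_
  have h1 := h i
  rcases lt_or_ge i N with hi | hi
  · have := key i (by simpa using hi)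
    omega
  · have := hN i hi
    omega

theorem emptyPartition_part (i : ℕ) : emptyPartition.part i = 0 := rfl

theorem eq_emptyPartition_of_le {mu : IntPartition} (h : ∀ i, mu.part i ≤ 0) :
    mu = emptyPartition :=
  IntPartition.ext_part fun i => Nat.le_zero.1 (h i)

/-! ### Conjugation -/

theorem IntPartition.finite_lt_part (lam : IntPartition) (j : ℕ) : {i | j < lam.part i}.Finite :=
  lam.finite_supp.subset fun i hi => by
    simp only [Set.mem_ofPred_eq] at hi
    simp only [Function.mem_support]
    omega

theorem IntPartition.lt_ncard_iff (lam : IntPartition) (i j : ℕ) :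
    i < {i | j < lam.part i}.ncard ↔ j < lam.part i := by
  have hfin := lam.finite_lt_part j
  constructor
  · intro h
    by_contra h'
    have hsub : {i | j < lam.part i} ⊆ (Finset.range i : Set ℕ) := fun k hk => by
      by_contra hk'
      have := lam.antitone (show i ≤ k by simpa using hk')
      simp only [Set.mem_ofPred_eq] at hk
      omega
    have := Set.ncard_le_ncard hsub (Finset.finite_toSet _)
    rw [Set.ncard_coe_finset, Finset.card_range] at this
    omega
  · intro h
    have hsub : (Finset.range (i + 1) : Set ℕ) ⊆ {i | j < lam.part i} := fun k hk => by
      have := lam.antitone (show k ≤ i by simpa [Nat.lt_succ_iff] using hk)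
      simp only [Set.mem_ofPred_eq]
      omega
    have := Set.ncard_le_ncard hsub hfin
    rw [Set.ncard_coe_finset, Finset.card_range] at this
    omega

/-- The conjugate partition. -/
noncomputable def IntPartition.conj (lam : IntPartition) : IntPartition where
  part j := {i | j < lam.part i}.ncard
  antitone j _ hjk := Set.ncard_le_ncard (fun _ hi => lt_of_le_of_lt hjk hi) (lam.finite_lt_part j)
  finite_supp := (Set.finite_lt_nat (lam.part 0)).subset fun j hj =>
    (lam.lt_ncard_iff 0 j).1 (Nat.pos_of_ne_zero hj)

theorem IntPartition.lt_conj_part_iff (lam : IntPartition) (i j : ℕ) :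
    i < lam.conj.part j ↔ j < lam.part i :=
  lam.lt_ncard_iff i j

theorem IntPartition.conj_conj (lam : IntPartition) : lam.conj.conj = lam :=
  ext_part fun i => eq_of_forall_lt_iff fun j => by rw [lt_conj_part_iff, lt_conj_part_iff]

/-- Conjugation as a permutation of the set of partitions. -/
noncomputable def IntPartition.conjEquiv : IntPartition ≃ IntPartition :=
  ⟨conj, conj, conj_conj, conj_conj⟩

theorem IntPartition.size_conj (lam : IntPartition) : lam.conj.size = lam.size := by
  obtain ⟨N, hN⟩ := lam.exists_bound
  obtain ⟨M, hM⟩ := lam.conj.exists_bound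
  have count (n b : ℕ) (h : n ≤ b) : n = ∑ j ∈ Finset.range b, if j < n then 1 else 0 := by
    rw [Finset.sum_boole, Nat.cast_id, show (Finset.range b).filter (· < n) = Finset.range n by
      ext; simp only [Finset.mem_filter, Finset.mem_range]; omega, Finset.card_range]
  have hl (i : ℕ) : lam.part i ≤ M := le_of_not_gt fun h => by
    have := (lam.lt_conj_part_iff i M).2 h
    have := hM M le_rfl
    omega
  have hc (j : ℕ) : lam.conj.part j ≤ N := le_of_not_gt fun h => by
    have := (lam.lt_conj_part_iff N j).1 h
    have := hN N le_rfl
    omega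
  rw [size_eq_sum hN, size_eq_sum hM, Finset.sum_congr rfl fun j _ => count _ N (hc j),
    Finset.sum_congr rfl fun i _ => count _ M (hl i), Finset.sum_comm]
  simp only [lt_conj_part_iff]

theorem IntPartition.le_iff_conj {lam mu : IntPartition} :
    (∀ i, mu.conj.part i ≤ lam.conj.part i) ↔ ∀ i, mu.part i ≤ lam.part i := by
  simp only [← forall_lt_iff_le, lt_conj_part_iff]
  exact forall_comm

theorem hStrip_conj_iff {mu lam : IntPartition} : HStrip mu.conj lam.conj ↔ VStrip mu lam := by
  unfold HStrip VStrip
  rw [forall_and, forall_and, IntPartition.le_iff_conj, and_comm]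
  refine and_congr_right fun _ => ⟨fun h i => ?_, fun h j => ?_⟩
  · by_contra! hlt
    have h1 := (lam.lt_conj_part_iff i _).2 hlt
    have h2 := (mu.lt_conj_part_iff i _).1 (h1.trans_le (h _))
    omega
  · by_contra! hlt
    have h1 := (lam.lt_conj_part_iff _ _).1 hlt
    have h2 := h (mu.conj.part j)
    have h3 := (mu.lt_conj_part_iff (mu.conj.part j) j).2 (by omega)
    omega

/-! ### Sums over partitions -/

theorem ENNReal.tsum_pi_prod {n : ℕ} {α : Type*} (w : Fin n → α → ℝ≥0∞) :
    ∑' f : Fin n → α, ∏ i, w i (f i) = ∏ i, ∑' a, w i a := by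
  induction n with
  | zero => simp
  | succ n ih =>
    rw [← (Fin.consEquiv fun _ : Fin (n + 1) => α).tsum_eq]
    simp only [Fin.consEquiv_apply, Fin.prod_univ_succ, Fin.cons_zero, Fin.cons_succ]
    rw [ENNReal.tsum_prod (f := fun (a : α) (f : Fin n → α) => w 0 a * ∏ i : Fin n, w i.succ (f i))]
    simp only [ENNReal.tsum_mul_left, ENNReal.tsum_mul_right, ih]

theorem tsum_partition_eq_prod {N : ℕ} (w : ℕ → ℕ → ℝ≥0∞) (F : IntPartition → ℝ≥0∞)
    (hw : ∀ a : ℕ → ℕ, (∀ i < N, w i (a i) ≠ 0) → (∀ i, N ≤ i → a i = 0) → Antitone a)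
    (hF : ∀ lam : IntPartition, (∀ i, N ≤ i → lam.part i = 0) →
      F lam = ∏ i ∈ Finset.range N, w i (lam.part i))
    (hF0 : ∀ lam : IntPartition, F lam ≠ 0 → ∀ i, N ≤ i → lam.part i = 0) :
    ∑' lam, F lam = ∏ i ∈ Finset.range N, ∑' a, w i a := by
  rw [Finset.prod_range fun i => ∑' a, w i a, ← ENNReal.tsum_pi_prod, eq_comm]
  refine tsum_eq_tsum_of_ne_zero_bij (fun lam i => lam.1.part i) ?_ ?_ ?_
  · rintro ⟨lam, hl⟩ ⟨mu, hm⟩ h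
    refine Subtype.ext (IntPartition.ext_part fun i => ?_)
    rcases lt_or_ge i N with hi | hi
    · exact congrFun h ⟨i, hi⟩
    · rw [hF0 lam hl i hi, hF0 mu hm i hi]
  · intro f hf
    set a : ℕ → ℕ := fun i => if h : i < N then f ⟨i, h⟩ else 0 with ha
    have ha0 : ∀ i, N ≤ i → a i = 0 := fun i hi => by simp [ha, hi]
    have haf (i : Fin N) : a i = f i := by simp [ha]
    have hanti : Antitone a := hw a (fun i hi => by
      have := Finset.prod_ne_zero_iff.1 hf ⟨i, hi⟩ (Finset.mem_univ _)
      rwa [← haf] at this) ha0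
    let lam : IntPartition := ⟨a, hanti, (Set.finite_lt_nat N).subset fun i hi => by
      by_contra h
      exact hi (ha0 i (by simpa using h))⟩
    refine ⟨⟨lam, ?_⟩, funext haf⟩
    rw [Function.mem_support, hF lam ha0, Finset.prod_range]
    simpa [lam, haf] using hf
  · rintro ⟨lam, hl⟩
    rw [hF lam (hF0 lam hl), Finset.prod_range]

/-- The generating function of a set of partitions defined row by row factors into row sums. -/
theorem tsum_partition_eq_prod_ite {N : ℕ} {Q : IntPartition → Prop} (P : ℕ → ℕ → Prop)
    [∀ i, DecidablePred (P i)] (w : ℕ → ℕ → ℝ≥0∞) (F : IntPartition → ℝ≥0∞)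
    (hQ : ∀ lam, Q lam ↔ ∀ i, P i (lam.part i))
    (hanti : ∀ i a b, P i a → P (i + 1) b → b ≤ a)
    (hN : ∀ i, N ≤ i → ∀ a, P i a ↔ a = 0)
    (hF : ∀ lam, (∀ i, N ≤ i → lam.part i = 0) → Q lam →
      F lam = ∏ i ∈ Finset.range N, w i (lam.part i))
    (hF0 : ∀ lam, ¬ Q lam → F lam = 0) :
    ∑' lam, F lam = ∏ i ∈ Finset.range N, ∑' a, if P i a then w i a else 0 := by
  refine tsum_partition_eq_prod (fun i a => if P i a then w i a else 0) _ (fun a h1 h2 => ?_)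
    (fun lam hl => ?_) fun lam hl i hi => ?_
  · have hP (i : ℕ) : P i (a i) := by
      rcases lt_or_ge i N with hi | hi
      · by_contra h
        exact h1 i hi (if_neg h)
      · exact (hN i hi _).2 (h2 i hi)
    exact antitone_nat_of_succ_le fun i => hanti i _ _ (hP i) (hP (i + 1))
  · by_cases h : Q lam
    · rw [hF lam hl h]
      exact Finset.prod_congr rfl fun i _ => (if_pos ((hQ lam).1 h i)).symm
    · have hP : ∃ i ∈ Finset.range N, ¬ P i (lam.part i) := by
        by_contra! hP
        refine h ((hQ lam).2 fun i => ?_)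
        rcases lt_or_ge i N with hi | hi
        · exact hP i (by simpa using hi)
        · exact (hN i hi _).2 (hl i hi)
      obtain ⟨i, hi, hP⟩ := hP
      rw [Finset.prod_eq_zero hi (if_neg hP), hF0 lam h]
  · by_contra h
    exact hl (hF0 lam fun hq => h ((hN i hi _).1 ((hQ lam).1 hq i)))

/-! ### Transfer kernels and their commutation relations -/

open Classical in
/-- The transfer kernel of an interlacing relation `R`, with weight `x` per added box. -/
noncomputable def stripKernel (R : IntPartition → IntPartition → Prop) (x : ℝ≥0∞)
    (mu lam : IntPartition) : ℝ≥0∞ :=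
  if R mu lam then x ^ (lam.size - mu.size) else 0

theorem stripKernel_conj (x : ℝ≥0∞) (mu lam : IntPartition) :
    stripKernel HStrip x mu.conj lam.conj = stripKernel VStrip x mu lam := by
  by_cases h : VStrip mu lam
  · simp [stripKernel, hStrip_conj_iff.2 h, h, IntPartition.size_conj]
  · simp [stripKernel, mt hStrip_conj_iff.1 h, h]

/-- Moving a removal step across an addition step produces the scalar `c`. -/
def SkewCommute (R S : IntPartition → IntPartition → Prop) (x y c : ℝ≥0∞) : Prop :=
  ∀ mu nu, ∑' lam, stripKernel R x mu lam * stripKernel S y nu lam =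
    c * ∑' kap, stripKernel S y kap mu * stripKernel R x kap nu

theorem SkewCommute.swap {R S : IntPartition → IntPartition → Prop} {x y c : ℝ≥0∞}
    (h : SkewCommute R S x y c) : SkewCommute S R y x c := fun mu nu => by
  simpa only [mul_comm (stripKernel S y _ _)] using h nu mu

theorem stripKernel_mul_eq_prod {R S : IntPartition → IntPartition → Prop} {x y : ℝ≥0∞}
    {mu nu lam rho : IntPartition} {N : ℕ} (hl : ∀ i, N ≤ i → lam.part i = 0)
    (hr : ∀ i, N ≤ i → rho.part i = 0)
    (hR : ∀ i, mu.part i ≤ lam.part i) (hS : ∀ i, nu.part i ≤ rho.part i)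
    (h1 : R mu lam) (h2 : S nu rho) :
    stripKernel R x mu lam * stripKernel S y nu rho = ∏ i ∈ Finset.range N,
      x ^ (lam.part i - mu.part i) * y ^ (rho.part i - nu.part i) := by
  rw [stripKernel, if_pos h1, stripKernel, if_pos h2, IntPartition.size_sub_eq_sum hl hR,
    IntPartition.size_sub_eq_sum hr hS, Finset.prod_mul_distrib, Finset.prod_pow_eq_pow_sum,
    Finset.prod_pow_eq_pow_sum]

theorem stripKernel_mul_eq_zero {R S : IntPartition → IntPartition → Prop} {x y : ℝ≥0∞}
    {mu nu lam rho : IntPartition} (h : ¬ (R mu lam ∧ S nu rho)) :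
    stripKernel R x mu lam * stripKernel S y nu rho = 0 := by
  rw [not_and_or] at h
  rcases h with h | h <;> simp [stripKernel, h]

/-- If the conditions defining the upper partition can be checked row by row, the left-hand side
of a commutation relation factors into row sums. -/
theorem tsum_stripKernel_up {R S : IntPartition → IntPartition → Prop} {x y : ℝ≥0∞}
    {mu nu : IntPartition} {N : ℕ} (P : ℕ → ℕ → Prop) [∀ i, DecidablePred (P i)]
    (hiff : ∀ lam, (R mu lam ∧ S nu lam) ↔ ∀ i, P i (lam.part i))
    (hP : ∀ i a, P i a → mu.part i ≤ a ∧ nu.part i ≤ a)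
    (hanti : ∀ i a b, P i a → P (i + 1) b → b ≤ a)
    (hN : ∀ i, N ≤ i → ∀ a, P i a ↔ a = 0) :
    ∑' lam, stripKernel R x mu lam * stripKernel S y nu lam = ∏ i ∈ Finset.range N,
      ∑' a, if P i a then x ^ (a - mu.part i) * y ^ (a - nu.part i) else 0 :=
  tsum_partition_eq_prod_ite P (fun i a => x ^ (a - mu.part i) * y ^ (a - nu.part i)) _
    hiff hanti hN
    (fun lam hl h => stripKernel_mul_eq_prod hl hl (fun i => (hP i _ ((hiff lam).1 h i)).1)
      (fun i => (hP i _ ((hiff lam).1 h i)).2) h.1 h.2)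
    fun _ => stripKernel_mul_eq_zero

/-- If the conditions defining the lower partition can be checked row by row, the right-hand side
of a commutation relation factors into row sums. -/
theorem tsum_stripKernel_down {R S : IntPartition → IntPartition → Prop} {x y : ℝ≥0∞}
    {mu nu : IntPartition} {N : ℕ} (P : ℕ → ℕ → Prop) [∀ i, DecidablePred (P i)]
    (hmu : ∀ i, N ≤ i → mu.part i = 0) (hnu : ∀ i, N ≤ i → nu.part i = 0)
    (hiff : ∀ kap, (S kap mu ∧ R kap nu) ↔ ∀ i, P i (kap.part i))
    (hP : ∀ i a, P i a → a ≤ mu.part i ∧ a ≤ nu.part i)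
    (hanti : ∀ i a b, P i a → P (i + 1) b → b ≤ a)
    (hN : ∀ i, N ≤ i → ∀ a, P i a ↔ a = 0) :
    ∑' kap, stripKernel S y kap mu * stripKernel R x kap nu = ∏ i ∈ Finset.range N,
      ∑' a, if P i a then y ^ (mu.part i - a) * x ^ (nu.part i - a) else 0 :=
  tsum_partition_eq_prod_ite P (fun i a => y ^ (mu.part i - a) * x ^ (nu.part i - a)) _
    hiff hanti hN
    (fun kap _ h => stripKernel_mul_eq_prod hmu hnu (fun i => (hP i _ ((hiff kap).1 h i)).1)
      (fun i => (hP i _ ((hiff kap).1 h i)).2) h.1 h.2)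
    fun _ => stripKernel_mul_eq_zero

theorem IntPartition.exists_common_bound (mu nu : IntPartition) :
    ∃ N, ∀ i, N ≤ i → mu.part i = 0 ∧ nu.part i = 0 := by
  obtain ⟨N, hN⟩ := mu.exists_bound
  obtain ⟨M, hM⟩ := nu.exists_bound
  exact ⟨N + M, fun i hi => ⟨hN i (by omega), hM i (by omega)⟩⟩

theorem tsum_ite_Icc {P : ℕ → Prop} [DecidablePred P] {f : ℕ → ℝ≥0∞} {l u : ℕ} (h : ∀ a, P a ↔ l ≤ a ∧ a ≤ u) :
    (∑' a, if P a then f a else 0) = ∑ a ∈ Finset.Icc l u, f a := by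
  rw [tsum_eq_sum (s := Finset.Icc l u) fun a ha => if_neg fun hP => ha (by
    simpa using (h a).1 hP)]
  exact Finset.sum_congr rfl fun a ha => if_pos ((h a).2 (by simpa using ha))

theorem sum_Icc_upper (x y : ℝ≥0∞) (m n u : ℕ) :
    ∑ a ∈ Finset.Icc (max m n) u, x ^ (a - m) * y ^ (a - n) =
      x ^ (max m n - m) * y ^ (max m n - n) *
        ∑ a ∈ Finset.Icc (max m n) u, (x * y) ^ (a - max m n) := by
  rw [Finset.mul_sum]
  refine Finset.sum_congr rfl fun a ha => ?_
  rw [Finset.mem_Icc] at ha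
  rw [show a - m = (max m n - m) + (a - max m n) by omega,
    show a - n = (max m n - n) + (a - max m n) by omega, pow_add, pow_add, mul_pow]
  ring

theorem sum_Icc_lower (x y : ℝ≥0∞) (m n l : ℕ) :
    ∑ a ∈ Finset.Icc l (min m n), y ^ (m - a) * x ^ (n - a) =
      x ^ (max m n - m) * y ^ (max m n - n) *
        ∑ a ∈ Finset.Icc l (min m n), (x * y) ^ (a - l) := by
  rw [Finset.mul_sum]
  refine Finset.sum_nbij' (fun a => l + min m n - a) (fun a => l + min m n - a) ?_ ?_ ?_ ?_ ?_
  · intro a ha; simp only [Finset.mem_Icc] at ha ⊢; omega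
  · intro a ha; simp only [Finset.mem_Icc] at ha ⊢; omega
  · intro a ha; simp only [Finset.mem_Icc] at ha ⊢; omega
  · intro a ha; simp only [Finset.mem_Icc] at ha ⊢; omega
  · intro a ha
    rw [Finset.mem_Icc] at ha
    rw [show m - a = (max m n - n) + (l + min m n - a - l) by omega,
      show n - a = (max m n - m) + (l + min m n - a - l) by omega, pow_add, pow_add, mul_pow]
    ring

theorem tsum_ite_max_le (x y : ℝ≥0∞) (m n : ℕ) :
    (∑' a, if m ≤ a ∧ n ≤ a then x ^ (a - m) * y ^ (a - n) else 0) =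
      x ^ (max m n - m) * y ^ (max m n - n) * (1 - x * y)⁻¹ := by
  rw [← ENNReal.tsum_geometric, ← ENNReal.tsum_mul_left,
    ← Summable.sum_add_tsum_nat_add' (k := max m n) ENNReal.summable,
    Finset.sum_eq_zero fun a ha => if_neg (by rw [Finset.mem_range] at ha; omega), zero_add]
  refine tsum_congr fun d => ?_
  rw [if_pos (by omega), show d + max m n - m = (max m n - m) + d by omega,
    show d + max m n - n = (max m n - n) + d by omega, pow_add, pow_add, mul_pow]
  ring

open Classical in
theorem skewCommute_hStrip_hStrip (x y : ℝ≥0∞) :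
    SkewCommute HStrip HStrip x y (1 - x * y)⁻¹ := fun mu nu => by
  obtain ⟨N, hN⟩ := mu.exists_common_bound nu
  have hN' (i : ℕ) (hi : N ≤ i) := hN (i + 1) (by omega)
  rw [tsum_stripKernel_up (N := N + 1) (fun i a => mu.part i ≤ a ∧ nu.part i ≤ a ∧
      ∀ j, i = j + 1 → a ≤ mu.part j ∧ a ≤ nu.part j),
    tsum_stripKernel_down (N := N) (fun i a => mu.part (i + 1) ≤ a ∧ nu.part (i + 1) ≤ a ∧
      a ≤ mu.part i ∧ a ≤ nu.part i)]
  · obtain ⟨A, hA⟩ : ∃ A : ℕ → ℝ≥0∞, ∀ i, A i =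
      x ^ (max (mu.part i) (nu.part i) - mu.part i) *
        y ^ (max (mu.part i) (nu.part i) - nu.part i) := ⟨_, fun _ => rfl⟩
    obtain ⟨G, hG⟩ : ∃ G : ℕ → ℝ≥0∞, ∀ i, G i =
      ∑ a ∈ Finset.Icc (max (mu.part (i + 1)) (nu.part (i + 1))) (min (mu.part i) (nu.part i)),
        (x * y) ^ (a - max (mu.part (i + 1)) (nu.part (i + 1))) := ⟨_, fun _ => rfl⟩
    rw [Finset.prod_range_succ', Finset.prod_congr rfl (g := fun i => A (i + 1) * G i),
      Finset.prod_congr (s₁ := Finset.range N) (f := fun i => ∑' a,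
        if mu.part (i + 1) ≤ a ∧ nu.part (i + 1) ≤ a ∧ a ≤ mu.part i ∧ a ≤ nu.part i then
          y ^ (mu.part i - a) * x ^ (nu.part i - a) else 0) rfl (g := fun i => A i * G i)]
    · have hAN : A N = 1 := by simp [hA, hN N le_rfl]
      have h0 : (∑' a, if mu.part 0 ≤ a ∧ nu.part 0 ≤ a ∧
          ∀ j, 0 = j + 1 → a ≤ mu.part j ∧ a ≤ nu.part j then
          x ^ (a - mu.part 0) * y ^ (a - nu.part 0) else 0) = A 0 * (1 - x * y)⁻¹ := by
        rw [hA, ← tsum_ite_max_le]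
        simp
      have h1 : (∏ i ∈ Finset.range N, A (i + 1)) * A 0 = ∏ i ∈ Finset.range N, A i := by
        rw [← Finset.prod_range_succ', Finset.prod_range_succ, hAN, mul_one]
      rw [h0, Finset.prod_mul_distrib, Finset.prod_mul_distrib, ← h1]
      ring
    · intro i _
      rw [hA, hG, ← sum_Icc_lower]
      refine tsum_ite_Icc fun a => ?_
      rw [max_le_iff, le_min_iff]
      tauto
    · intro i _
      rw [hA, hG, ← sum_Icc_upper]
      refine tsum_ite_Icc fun a => ?_
      simp only [Nat.add_right_cancel_iff, forall_eq', max_le_iff, le_min_iff]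
      tauto
  · exact fun i hi => (hN i hi).1
  · exact fun i hi => (hN i hi).2
  · intro kap
    simp only [HStrip, ← forall_and]
    exact forall_congr' fun i => by omega
  · intro i a h; omega
  · intro i a b h h'; omega
  · intro i hi a
    have := hN i hi
    have := hN' i hi
    omega
  · intro lam
    refine ⟨fun h i => ⟨(h.1 i).2, (h.2 i).2, ?_⟩, fun h => ⟨fun i => ⟨?_, (h i).1⟩, fun i =>
      ⟨?_, (h i).2.1⟩⟩⟩
    · rintro j rfl
      exact ⟨(h.1 j).1, (h.2 j).1⟩
    · exact ((h (i + 1)).2.2 i rfl).1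
    · exact ((h (i + 1)).2.2 i rfl).2
  · exact fun i a h => ⟨h.1, h.2.1⟩
  · exact fun i a b h h' => ((h'.2.2 i rfl).1.trans h.1)
  · intro i hi a
    obtain ⟨j, rfl⟩ : ∃ j, i = j + 1 := ⟨i - 1, by omega⟩
    have := hN j (by omega)
    have := hN' j (by omega)
    simp only [Nat.add_right_cancel_iff, forall_eq']
    omega

theorem skewCommute_vStrip_vStrip (x y : ℝ≥0∞) :
    SkewCommute VStrip VStrip x y (1 - x * y)⁻¹ := fun mu nu => by
  have h := skewCommute_hStrip_hStrip x y mu.conj nu.conj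
  rw [← IntPartition.conjEquiv.tsum_eq, ← IntPartition.conjEquiv.tsum_eq (fun kap =>
    stripKernel HStrip y kap mu.conj * stripKernel HStrip x kap nu.conj)] at h
  simpa only [IntPartition.conjEquiv, Equiv.coe_fn_mk, stripKernel_conj] using h

/-- The two-row computation behind the mixed commutation relation. -/
theorem mixed_row_identity (x y : ℝ≥0∞) {m n c k : ℕ} (hmc : m ≤ c) (hkn : k ≤ n) :
    (∑ a ∈ Finset.Icc (max m n) (min (n + 1) c), x ^ (a - m) * y ^ (a - n)) *
        (if k < m then 1 + x * y else if k = m then 1 else 0) =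
      (∑ a ∈ Finset.Icc (max (m - 1) k) (min m n), y ^ (m - a) * x ^ (n - a)) *
        (if n < c then 1 + x * y else if n = c then 1 else 0) := by
  rcases lt_trichotomy m (n + 1) with h | rfl | h
  · have hmn : m ≤ n := by omega
    obtain ⟨d, rfl⟩ := Nat.exists_eq_add_of_le hmn
    have hU : (∑ a ∈ Finset.Icc (max m (m + d)) (min (m + d + 1) c),
        x ^ (a - m) * y ^ (a - (m + d))) =
        x ^ d * (if m + d < c then 1 + x * y else if m + d = c then 1 else 0) := by
      rw [max_eq_right hmn]
      split_ifs with h1 h2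
      · rw [min_eq_left h1, Finset.sum_Icc_succ_top (by omega), Finset.Icc_self,
          Finset.sum_singleton, Nat.add_sub_cancel_left, Nat.sub_self,
          show m + d + 1 - m = d + 1 by omega, show m + d + 1 - (m + d) = 1 by omega]
        ring
      · subst h2
        rw [min_eq_right (by omega), Finset.Icc_self, Finset.sum_singleton,
          Nat.add_sub_cancel_left, Nat.sub_self]
        ring
      · rw [Finset.Icc_eq_empty (by omega), Finset.sum_empty, mul_zero]
    have hD : (∑ a ∈ Finset.Icc (max (m - 1) k) (min m (m + d)),
        y ^ (m - a) * x ^ (m + d - a)) =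
        x ^ d * (if k < m then 1 + x * y else if k = m then 1 else 0) := by
      rw [min_eq_left hmn]
      split_ifs with h1 h2
      · obtain ⟨e, rfl⟩ : ∃ e, m = e + 1 := ⟨m - 1, by omega⟩
        rw [max_eq_left (by omega), Nat.add_sub_cancel, Finset.sum_Icc_succ_top (by omega),
          Finset.Icc_self, Finset.sum_singleton, Nat.sub_self, show e + 1 + d - (e + 1) = d by omega,
          show e + 1 + d - e = d + 1 by omega, show e + 1 - e = 1 by omega]
        ring
      · subst h2
        rw [max_eq_right (by omega), Finset.Icc_self, Finset.sum_singleton,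
          Nat.add_sub_cancel_left, Nat.sub_self]
        ring
      · rw [Finset.Icc_eq_empty (by omega), Finset.sum_empty, mul_zero]
    rw [hU, hD]
    ring
  · rw [if_pos (by omega), if_pos (by omega), max_eq_left (by omega), min_eq_left hmc,
      Nat.add_sub_cancel, max_eq_left hkn, min_eq_right (by omega)]
    simp
  · rw [Finset.Icc_eq_empty (by omega), Finset.Icc_eq_empty (by omega)]
    simp

/-- The upper bound that `mu` imposes on row `i` of a partition containing it as a horizontal
strip; in row `0` there is none, and `b` is put in its place. -/
def rowCap (b : ℕ) (mu : IntPartition) : ℕ → ℕ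
  | 0 => b
  | i + 1 => mu.part i

theorem skewCommute_hStrip_vStrip (x y : ℝ≥0∞) :
    SkewCommute HStrip VStrip x y (1 + x * y) := fun mu nu => by
  obtain ⟨N, hN⟩ := mu.exists_common_bound nu
  set cap : ℕ → ℕ := rowCap (mu.part 0 + nu.part 0 + 1) mu with hcap
  have hcap0 : cap 0 = mu.part 0 + nu.part 0 + 1 := rfl
  have hcaps (i : ℕ) : cap (i + 1) = mu.part i := rfl
  have hmucap (i : ℕ) : mu.part i ≤ cap i := by
    cases i with
    | zero => omega
    | succ i => exact mu.antitone (Nat.le_succ i)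
  have hnu (i : ℕ) : nu.part (i + 1) ≤ nu.part i := nu.antitone (Nat.le_succ i)
  rw [tsum_stripKernel_up (N := N + 1) (fun i a => mu.part i ≤ a ∧ nu.part i ≤ a ∧
      a ≤ nu.part i + 1 ∧ a ≤ cap i),
    tsum_stripKernel_down (N := N + 1) (fun i a => a ≤ mu.part i ∧ mu.part i ≤ a + 1 ∧
      nu.part (i + 1) ≤ a ∧ a ≤ nu.part i)]
  · set U : ℕ → ℝ≥0∞ := fun i => ∑' a, if mu.part i ≤ a ∧ nu.part i ≤ a ∧
      a ≤ nu.part i + 1 ∧ a ≤ cap i then x ^ (a - mu.part i) * y ^ (a - nu.part i) else 0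
    set D : ℕ → ℝ≥0∞ := fun i => ∑' a, if a ≤ mu.part i ∧ mu.part i ≤ a + 1 ∧
      nu.part (i + 1) ≤ a ∧ a ≤ nu.part i then
      y ^ (mu.part i - a) * x ^ (nu.part i - a) else 0
    set E : ℕ → ℝ≥0∞ := fun i => if nu.part i < cap i then 1 + x * y else
      if nu.part i = cap i then 1 else 0 with hE
    have hrow (i : ℕ) : U i * E (i + 1) = D i * E i := by
      refine (congrArg₂ _ (tsum_ite_Icc fun a => ?_) rfl).trans
        ((mixed_row_identity x y (hmucap i) (hnu i)).trans
          (congrArg₂ _ (tsum_ite_Icc fun a => ?_).symm rfl))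
      · rw [max_le_iff, le_min_iff]; tauto
      · rw [max_le_iff, le_min_iff]; omega
    have hprod (n : ℕ) : (∏ i ∈ Finset.range n, U i) * E n =
        E 0 * ∏ i ∈ Finset.range n, D i := by
      induction n with
      | zero => simp
      | succ n ih =>
        rw [Finset.prod_range_succ, mul_assoc, hrow, mul_left_comm, ih, Finset.prod_range_succ]
        ring
    have hE0 : E 0 = 1 + x * y := if_pos (by omega)
    have hEN : E (N + 1) = 1 := by
      simp [hE, hcaps, hN N le_rfl, hN (N + 1) (by omega)]
    have h := hprod (N + 1)
    rwa [hEN, mul_one, hE0] at h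
  · exact fun i hi => (hN i (by omega)).1
  · exact fun i hi => (hN i (by omega)).2
  · intro kap
    simp only [HStrip, VStrip, ← forall_and]
    exact forall_congr' fun i => by omega
  · intro i a h; omega
  · intro i a b h h'; omega
  · intro i hi a
    have := hN i (by omega)
    have := hnu i
    omega
  · intro lam
    refine ⟨fun h i => ⟨(h.1 i).2, (h.2 i).1, (h.2 i).2, ?_⟩, fun h => ⟨fun i => ⟨?_, (h i).1⟩,
      fun i => ⟨(h i).2.1, (h i).2.2.1⟩⟩⟩
    · cases i with
      | zero =>
        have := (h.2 0).2
        omega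
      | succ i => exact (h.1 i).1
    · exact (h (i + 1)).2.2.2
  · exact fun i a h => ⟨h.1, h.2.1⟩
  · exact fun i a b h h' => h'.2.2.2.trans h.1
  · intro i hi a
    obtain ⟨j, rfl⟩ : ∃ j, i = j + 1 := ⟨i - 1, by omega⟩
    have := hN j (by omega)
    have := hN (j + 1) (by omega)
    have := hcaps j
    omega

theorem skewCommute_vStrip_hStrip (x y : ℝ≥0∞) :
    SkewCommute VStrip HStrip x y (1 + x * y) := by
  simpa only [mul_comm y x] using (skewCommute_hStrip_vStrip y x).swap

/-! ### The sequence of interlacing relations -/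

/-- The type of strip at the step from `X` to `X + 1`. -/
def stripRel (X : ℤ) : IntPartition → IntPartition → Prop :=
  if X % 4 = 0 ∨ X % 4 = 2 then HStrip else VStrip

/-- The interlacing condition at the step from `X` to `X + 1`: partitions grow if `X` is `0` or `1`
modulo `4`, and shrink otherwise. -/
def stepRel (X : ℤ) (mu lam : IntPartition) : Prop :=
  if X % 4 < 2 then stripRel X mu lam else stripRel X lam mu

/-- The scalar produced by moving the removal step `Y` across the addition step `X`. -/
noncomputable def pairFactor (v : ℤ → ℝ≥0∞) (X Y : ℤ) : ℝ≥0∞ :=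
  if (X % 4 = 0 ∨ X % 4 = 2) ↔ (Y % 4 = 0 ∨ Y % 4 = 2) then (1 - v X * v Y)⁻¹ else 1 + v X * v Y

theorem skewCommute_stripRel (v : ℤ → ℝ≥0∞) (X Y : ℤ) :
    SkewCommute (stripRel X) (stripRel Y) (v X) (v Y) (pairFactor v X Y) := by
  unfold stripRel pairFactor
  by_cases hX : X % 4 = 0 ∨ X % 4 = 2 <;> by_cases hY : Y % 4 = 0 ∨ Y % 4 = 2 <;>
    simp only [hX, hY, if_true, if_false, iff_true, iff_false, not_true]
  · exact skewCommute_hStrip_hStrip _ _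
  · exact skewCommute_hStrip_vStrip _ _
  · exact skewCommute_vStrip_hStrip _ _
  · exact skewCommute_vStrip_vStrip _ _

theorem part_le_of_stripRel {X : ℤ} {mu lam : IntPartition} (h : stripRel X mu lam) (i : ℕ) :
    mu.part i ≤ lam.part i := by
  unfold stripRel at h
  split_ifs at h
  exacts [(h i).2, (h i).1]

theorem stripRel_empty (X : ℤ) : stripRel X emptyPartition emptyPartition := by
  unfold stripRel
  split_ifs <;> simp [HStrip, VStrip, emptyPartition_part]

theorem stepRel_empty (X : ℤ) : stepRel X emptyPartition emptyPartition := by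
  unfold stepRel
  split_ifs <;> exact stripRel_empty X

theorem eq_of_stepRel_of_size_eq {X : ℤ} {mu lam : IntPartition} (h : stepRel X mu lam)
    (hs : lam.size = mu.size) : mu = lam := by
  unfold stepRel at h
  split_ifs at h
  · exact IntPartition.eq_of_size_le (part_le_of_stripRel h) hs.le
  · exact (IntPartition.eq_of_size_le (part_le_of_stripRel h) hs.ge).symm

theorem forall_stepRel_iff (lam : ℤ → IntPartition) :
    (∀ X, stepRel X (lam X) (lam (X + 1))) ↔ ∀ k : ℤ,
      HStrip (lam (4 * k)) (lam (4 * k + 1)) ∧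
      VStrip (lam (4 * k + 1)) (lam (4 * k + 2)) ∧
      HStrip (lam (4 * k + 3)) (lam (4 * k + 2)) ∧
      VStrip (lam (4 * k + 4)) (lam (4 * k + 3)) := by
  have h0 (k : ℤ) : stepRel (4 * k) = HStrip := by
    funext mu lam
    simp [stepRel, stripRel]
  have h1 (k : ℤ) : stepRel (4 * k + 1) = VStrip := by
    funext mu lam
    simp [stepRel, stripRel, Int.add_emod]
  have h2 (k : ℤ) : stepRel (4 * k + 2) = fun mu lam => HStrip lam mu := by
    funext mu lam
    simp [stepRel, stripRel, Int.add_emod]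
  have h3 (k : ℤ) : stepRel (4 * k + 3) = fun mu lam => VStrip lam mu := by
    funext mu lam
    simp [stepRel, stripRel, Int.add_emod]
  constructor
  · intro h k
    have e0 := h (4 * k)
    have e1 := h (4 * k + 1)
    have e2 := h (4 * k + 2)
    have e3 := h (4 * k + 3)
    rw [h0] at e0
    rw [h1, show 4 * k + 1 + 1 = 4 * k + 2 by ring] at e1
    rw [h2, show 4 * k + 2 + 1 = 4 * k + 3 by ring] at e2
    rw [h3, show 4 * k + 3 + 1 = 4 * k + 4 by ring] at e3
    exact ⟨e0, e1, e2, e3⟩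
  · intro h X
    obtain ⟨e0, e1, e2, e3⟩ := h (X / 4)
    have hX : X = 4 * (X / 4) ∨ X = 4 * (X / 4) + 1 ∨ X = 4 * (X / 4) + 2 ∨
        X = 4 * (X / 4) + 3 := by omega
    generalize X / 4 = k at *
    rcases hX with rfl | rfl | rfl | rfl
    · rwa [h0]
    · rwa [h1, show 4 * k + 1 + 1 = 4 * k + 2 by ring]
    · rwa [h2, show 4 * k + 2 + 1 = 4 * k + 3 by ring]
    · rwa [h3, show 4 * k + 3 + 1 = 4 * k + 4 by ring]

/-! ### The transfer-matrix computation -/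

/-- The transfer kernel of the step from `X` to `X + 1`. -/
noncomputable def stepKernel (v : ℤ → ℝ≥0∞) (X : ℤ) (mu lam : IntPartition) : ℝ≥0∞ :=
  if X % 4 < 2 then stripKernel (stripRel X) (v X) mu lam else stripKernel (stripRel X) (v X) lam mu

open Classical in
theorem stepKernel_eq (v : ℤ → ℝ≥0∞) (X : ℤ) (mu lam : IntPartition) :
    stepKernel v X mu lam = if stepRel X mu lam then
      v X ^ ((lam.size : ℤ) - (mu.size : ℤ)).natAbs else 0 := by
  unfold stepKernel stepRel stripKernel
  split_ifs with h1 h2 h2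
  · have := IntPartition.size_le (part_le_of_stripRel h2)
    congr 1
    omega
  · rfl
  · have := IntPartition.size_le (part_le_of_stripRel h2)
    congr 1
    omega
  · rfl

/-- The action of a kernel on functions of partitions. -/
noncomputable def evolve (K : IntPartition → IntPartition → ℝ≥0∞) (f : IntPartition → ℝ≥0∞)
    (lam : IntPartition) : ℝ≥0∞ :=
  ∑' mu, f mu * K mu lam

theorem evolve_const_mul (K : IntPartition → IntPartition → ℝ≥0∞) (c : ℝ≥0∞)
    (f : IntPartition → ℝ≥0∞) : evolve K (fun mu => c * f mu) = fun lam => c * evolve K f lam := by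
  funext lam
  simp only [evolve, mul_assoc, ENNReal.tsum_mul_left]

theorem evolve_evolve (K L : IntPartition → IntPartition → ℝ≥0∞) (f : IntPartition → ℝ≥0∞)
    (nu : IntPartition) :
    evolve L (evolve K f) nu = ∑' mu, f mu * ∑' lam, K mu lam * L lam nu := by
  simp only [evolve, ← ENNReal.tsum_mul_left, ← ENNReal.tsum_mul_right]
  rw [ENNReal.tsum_comm]
  simp only [mul_assoc]

theorem SkewCommute.evolve_comm {R S : IntPartition → IntPartition → Prop} {x y c : ℝ≥0∞}
    (h : SkewCommute R S x y c) (f : IntPartition → ℝ≥0∞) :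
    evolve (fun lam nu => stripKernel S y nu lam) (evolve (stripKernel R x) f) = fun nu =>
      c * evolve (stripKernel R x) (evolve (fun mu kap => stripKernel S y kap mu) f) nu := by
  funext nu
  rw [evolve_evolve, evolve_evolve, ← ENNReal.tsum_mul_left]
  refine tsum_congr fun mu => ?_
  rw [h mu nu]
  ring

open Classical in
/-- The indicator function of the empty partition. -/
noncomputable def vacuum (lam : IntPartition) : ℝ≥0∞ :=
  if lam = emptyPartition then 1 else 0

theorem tsum_mul_vacuum (f : IntPartition → ℝ≥0∞) :
    ∑' lam, f lam * vacuum lam = f emptyPartition := by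
  rw [tsum_eq_single emptyPartition fun lam h => by simp [vacuum, h]]
  simp [vacuum]

theorem stripKernel_empty_right (X : ℤ) (x : ℝ≥0∞) (mu : IntPartition) :
    stripKernel (stripRel X) x mu emptyPartition = vacuum mu := by
  by_cases h : mu = emptyPartition
  · subst h
    simp [stripKernel, vacuum, stripRel_empty]
  · rw [vacuum, if_neg h, stripKernel, if_neg fun hR => h (eq_emptyPartition_of_le
      (part_le_of_stripRel hR))]

/-- The state after the first `n` steps from position `a`, starting with the empty partition. -/
noncomputable def state (v : ℤ → ℝ≥0∞) (a : ℤ) : ℕ → IntPartition → ℝ≥0∞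
  | 0 => vacuum
  | n + 1 => evolve (stepKernel v (a + n)) (state v a n)

/-- The state obtained by keeping only the addition steps. -/
noncomputable def growthState (v : ℤ → ℝ≥0∞) (a : ℤ) : ℕ → IntPartition → ℝ≥0∞
  | 0 => vacuum
  | n + 1 => if (a + n) % 4 < 2 then
      evolve (stripKernel (stripRel (a + n)) (v (a + n))) (growthState v a n)
    else growthState v a n

theorem growthState_empty (v : ℤ → ℝ≥0∞) (a : ℤ) (n : ℕ) :
    growthState v a n emptyPartition = 1 := by
  induction n with
  | zero => simp [growthState, vacuum]
  | succ n ih =>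
    rw [growthState]
    split_ifs
    · simp only [evolve, stripKernel_empty_right, tsum_mul_vacuum, ih]
    · exact ih

theorem evolve_growthState (v : ℤ → ℝ≥0∞) (a Y : ℤ) (n : ℕ) :
    evolve (fun mu kap => stripKernel (stripRel Y) (v Y) kap mu) (growthState v a n) = fun lam =>
      (∏ i ∈ Finset.range n, if (a + i) % 4 < 2 then pairFactor v (a + i) Y else 1) *
        growthState v a n lam := by
  induction n with
  | zero =>
    funext lam
    simp only [growthState, evolve, mul_comm (vacuum _), tsum_mul_vacuum, stripKernel_empty_right,
      Finset.range_zero, Finset.prod_empty, one_mul]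
  | succ n ih =>
    rw [growthState, Finset.prod_range_succ]
    split_ifs
    · rw [(skewCommute_stripRel v (a + n) Y).evolve_comm, ih, evolve_const_mul]
      funext lam
      ring
    · simpa using ih

theorem state_eq (v : ℤ → ℝ≥0∞) (a : ℤ) (n : ℕ) :
    state v a n = fun lam => (∏ m ∈ Finset.range n, ∏ i ∈ Finset.range m,
      if (a + i) % 4 < 2 ∧ 2 ≤ (a + m) % 4 then pairFactor v (a + i) (a + m) else 1) *
        growthState v a n lam := by
  induction n with
  | zero =>
    funext lam
    simp [state, growthState]
  | succ n ih =>
    rw [state, ih, evolve_const_mul, growthState, Finset.prod_range_succ]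
    funext lam
    by_cases h : (a + n) % 4 < 2
    · have hK : stepKernel v (a + n) = stripKernel (stripRel (a + n)) (v (a + n)) := by
        funext mu nu
        exact if_pos h
      simp [h, not_le.2 h, hK]
    · have hK : stepKernel v (a + n) =
          fun mu kap => stripKernel (stripRel (a + n)) (v (a + n)) kap mu := by
        funext mu nu
        exact if_neg h
      simp only [h, hK, if_false, evolve_growthState, not_lt.1 h, and_true]
      ring

/-- The sum over paths of a given length is computed by iterating the transfer kernels. -/
theorem tsum_path_eq (v : ℤ → ℝ≥0∞) (a : ℤ) (n : ℕ) (g : IntPartition → ℝ≥0∞) :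
    ∑' p : Fin (n + 1) → IntPartition, vacuum (p 0) *
      (∏ i : Fin n, stepKernel v (a + (i : ℕ)) (p i.castSucc) (p i.succ)) * g (p (Fin.last n)) =
      ∑' lam, state v a n lam * g lam := by
  induction n generalizing g with
  | zero =>
    rw [← (Equiv.funUnique (Fin 1) IntPartition).symm.tsum_eq]
    simp [state]
  | succ n ih =>
    rw [← (Fin.snocEquiv fun _ : Fin (n + 2) => IntPartition).tsum_eq, ENNReal.tsum_prod',
      ENNReal.tsum_comm]
    have key (p : Fin (n + 1) → IntPartition) (lam : IntPartition) :
        vacuum ((Fin.snocEquiv fun _ : Fin (n + 2) => IntPartition) (lam, p) 0) *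
          (∏ i : Fin (n + 1), stepKernel v (a + (i : ℕ))
            ((Fin.snocEquiv fun _ : Fin (n + 2) => IntPartition) (lam, p) i.castSucc)
            ((Fin.snocEquiv fun _ : Fin (n + 2) => IntPartition) (lam, p) i.succ)) *
          g ((Fin.snocEquiv fun _ : Fin (n + 2) => IntPartition) (lam, p) (Fin.last (n + 1))) =
        vacuum (p 0) *
          (∏ i : Fin n, stepKernel v (a + (i : ℕ)) (p i.castSucc) (p i.succ)) *
          (stepKernel v (a + n) (p (Fin.last n)) lam * g lam) := by
      have e (i : Fin (n + 1)) :
          (Fin.snocEquiv fun _ : Fin (n + 2) => IntPartition) (lam, p) i.castSucc = p i := by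
        simp [Fin.snocEquiv]
      have e' : (Fin.snocEquiv fun _ : Fin (n + 2) => IntPartition) (lam, p) (Fin.last (n + 1)) =
          lam := by
        simp [Fin.snocEquiv]
      rw [Fin.prod_univ_castSucc, e', ← Fin.castSucc_zero, e, Fin.succ_last, e', e]
      simp only [e, Fin.succ_castSucc, Fin.val_castSucc, Fin.val_last]
      ring
    simp only [key, ENNReal.tsum_mul_left]
    rw [ih fun mu => ∑' lam, stepKernel v (a + n) mu lam * g lam]
    simp only [state, evolve, ← ENNReal.tsum_mul_left, ← ENNReal.tsum_mul_right]
    rw [ENNReal.tsum_comm]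
    simp only [mul_assoc]

/-! ### Configurations as finite paths -/

theorem SchurSeq.ext_lam {σ τ : SchurSeq} (h : ∀ X, σ.lam X = τ.lam X) : σ = τ := by
  cases σ; cases τ
  congr
  exact funext h

theorem SchurSeq.stepRel (σ : SchurSeq) (X : ℤ) : stepRel X (σ.lam X) (σ.lam (X + 1)) :=
  (forall_stepRel_iff σ.lam).2 σ.inter X

theorem SchurSeq.exists_bound (σ : SchurSeq) :
    ∃ B : ℕ, ∀ X : ℤ, B ≤ X.natAbs → σ.lam X = emptyPartition := by
  obtain ⟨B, hB⟩ := (σ.finite.image fun X => X.natAbs).bddAbove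
  refine ⟨B + 1, fun X hX => ?_⟩
  by_contra h
  have := hB (Set.mem_image_of_mem _ (show X ∈ {X : ℤ | σ.lam X ≠ emptyPartition} from h))
  omega

theorem SchurSeq.finite_mulSupport (v : ℤ → ℝ) (σ : SchurSeq) :
    (Function.mulSupport fun X : ℤ =>
      v X ^ ((((σ.lam (X + 1)).size : ℤ) - ((σ.lam X).size : ℤ)).natAbs)).Finite := by
  obtain ⟨B, hB⟩ := σ.exists_bound
  refine (Set.finite_Icc (-(B : ℤ) - 1) B).subset fun X hX => ?_
  by_contra h
  rw [Set.mem_Icc] at h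
  refine hX ?_
  simp only [hB X (by omega), hB (X + 1) (by omega), sub_self, Int.natAbs_zero, pow_zero]

theorem SchurSeq.eq_succ_of_steepWeight_ne_zero {v : ℤ → ℝ} {σ : SchurSeq}
    (h : steepWeight v σ ≠ 0) {X : ℤ} (hX : v X = 0) : σ.lam X = σ.lam (X + 1) := by
  refine eq_of_stepRel_of_size_eq (σ.stepRel X) ?_
  by_contra hs
  refine h (finprod_eq_zero _ X ?_ (σ.finite_mulSupport v))
  rw [hX]
  exact zero_pow (by omega)

theorem SchurSeq.eq_empty_of_steepWeight_ne_zero {v : ℤ → ℝ} {a : ℤ} {n : ℕ}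
    (hv : ∀ X, X < a ∨ a + n ≤ X → v X = 0) {σ : SchurSeq} (h : steepWeight v σ ≠ 0) {X : ℤ}
    (hX : X ≤ a ∨ a + n ≤ X) : σ.lam X = emptyPartition := by
  obtain ⟨B, hB⟩ := σ.exists_bound
  rcases hX with hX | hX
  · have hstep (k : ℕ) : σ.lam (X - k) = σ.lam X := by
      induction k with
      | zero => simp
      | succ k ih =>
        rw [eq_succ_of_steepWeight_ne_zero h (hv _ (by push_cast; omega)), ← ih]
        congr 1
        push_cast
        ring
    rw [← hstep (B + X.natAbs), hB]
    omega
  · have hstep (k : ℕ) : σ.lam (X + k) = σ.lam X := by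
      induction k with
      | zero => simp
      | succ k ih =>
        rw [← ih, eq_succ_of_steepWeight_ne_zero h (hv (X + k) (by omega))]
        congr 1
        push_cast
        ring
    rw [← hstep (B + X.natAbs), hB]
    omega

theorem ofReal_steepWeight {v : ℤ → ℝ} (hv0 : ∀ X, 0 ≤ v X) {a : ℤ} {n : ℕ} {σ : SchurSeq}
    (hσ : ∀ X, X ≤ a ∨ a + n ≤ X → σ.lam X = emptyPartition) :
    ENNReal.ofReal (steepWeight v σ) = ∏ i : Fin n,
      stepKernel (fun X => ENNReal.ofReal (v X)) (a + (i : ℕ)) (σ.lam (a + (i : ℕ)))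
        (σ.lam (a + (i : ℕ) + 1)) := by
  have hinj : Set.InjOn (fun i : ℕ => a + (i : ℤ)) (Finset.range n) := fun i _ j _ h => by
    simpa using h
  rw [steepWeight, finprod_eq_prod_of_mulSupport_subset
    (s := (Finset.range n).image fun i : ℕ => a + (i : ℤ)), Finset.prod_image hinj,
    ENNReal.ofReal_prod_of_nonneg fun i _ => pow_nonneg (hv0 _) _,
    Finset.prod_range fun i : ℕ => ENNReal.ofReal (v (a + i) ^
      ((((σ.lam (a + i + 1)).size : ℤ) - ((σ.lam (a + i)).size : ℤ)).natAbs))]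
  · refine Finset.prod_congr rfl fun i _ => ?_
    rw [stepKernel_eq, if_pos (σ.stepRel _), ENNReal.ofReal_pow (hv0 _)]
  · intro X hX
    by_contra h
    have h' : X < a ∨ a + n ≤ X := by
      by_contra! h'
      refine h ?_
      simp only [Finset.coe_image, Set.mem_image, Finset.coe_range, Set.mem_Iio]
      exact ⟨(X - a).toNat, by omega, by omega⟩
    refine hX ?_
    simp only [hσ X (by omega), hσ (X + 1) (by omega), sub_self, Int.natAbs_zero, pow_zero]

/-- Extension of a finite path by empty partitions. -/
noncomputable def extendPath (a : ℤ) {n : ℕ} (p : Fin (n + 1) → IntPartition) (X : ℤ) :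
    IntPartition :=
  if h : a ≤ X ∧ X ≤ a + n then p ⟨(X - a).toNat, by omega⟩ else emptyPartition

theorem extendPath_add (a : ℤ) {n : ℕ} (p : Fin (n + 1) → IntPartition) (i : Fin (n + 1)) :
    extendPath a p (a + (i : ℕ)) = p i := by
  rw [extendPath, dif_pos (by omega)]
  congr 1
  exact Fin.ext (by simp)

theorem extendPath_eq_empty {a : ℤ} {n : ℕ} {p : Fin (n + 1) → IntPartition}
    (h0 : p 0 = emptyPartition) (hn : p (Fin.last n) = emptyPartition) {X : ℤ}
    (hX : X ≤ a ∨ a + n ≤ X) : extendPath a p X = emptyPartition := by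
  by_cases h : a ≤ X ∧ X ≤ a + n
  · rcases hX with hX | hX
    · obtain rfl : X = a + ((0 : Fin (n + 1)) : ℕ) := by simp; omega
      rw [extendPath_add, h0]
    · obtain rfl : X = a + (Fin.last n : ℕ) := by simp; omega
      rw [extendPath_add, hn]
  · exact dif_neg h

theorem stepRel_extendPath {a : ℤ} {n : ℕ} {p : Fin (n + 1) → IntPartition}
    (h0 : p 0 = emptyPartition) (hn : p (Fin.last n) = emptyPartition)
    (hp : ∀ i : Fin n, stepRel (a + (i : ℕ)) (p i.castSucc) (p i.succ)) (X : ℤ) :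
    stepRel X (extendPath a p X) (extendPath a p (X + 1)) := by
  by_cases h : a ≤ X ∧ X < a + n
  · obtain ⟨i, rfl⟩ : ∃ i : Fin n, X = a + (i : ℕ) :=
      ⟨⟨(X - a).toNat, by omega⟩, by simp only; omega⟩
    have h1 := extendPath_add a p i.castSucc
    have h2 := extendPath_add a p i.succ
    rw [Fin.val_castSucc] at h1
    rw [Fin.val_succ, Nat.cast_add, Nat.cast_one, ← add_assoc] at h2
    rw [h1, h2]
    exact hp i
  · rw [extendPath_eq_empty h0 hn (by omega), extendPath_eq_empty h0 hn (by omega)]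
    exact stepRel_empty X

theorem tsum_ofReal_steepWeight {v : ℤ → ℝ} (hv0 : ∀ X, 0 ≤ v X) {a : ℤ} {n : ℕ}
    (hv : ∀ X, X < a ∨ a + n ≤ X → v X = 0) :
    ∑' σ, ENNReal.ofReal (steepWeight v σ) =
      state (fun X => ENNReal.ofReal (v X)) a n emptyPartition := by
  rw [← tsum_mul_vacuum (state _ a n), ← tsum_path_eq]
  have hempty (σ : Function.support fun σ => ENNReal.ofReal (steepWeight v σ)) {X : ℤ}
      (hX : X ≤ a ∨ a + n ≤ X) : σ.1.lam X = emptyPartition :=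
    SchurSeq.eq_empty_of_steepWeight_ne_zero hv
      (fun h => σ.2 (by simp [h])) hX
  have hval (σ : SchurSeq) (hσ : ∀ X, X ≤ a ∨ a + n ≤ X → σ.lam X = emptyPartition) :
      vacuum (σ.lam (a + ((0 : Fin (n + 1)) : ℕ))) *
        (∏ i : Fin n, stepKernel (fun X => ENNReal.ofReal (v X)) (a + (i : ℕ))
          (σ.lam (a + (i.castSucc : ℕ))) (σ.lam (a + (i.succ : ℕ)))) *
        vacuum (σ.lam (a + (Fin.last n : ℕ))) = ENNReal.ofReal (steepWeight v σ) := by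
    rw [ofReal_steepWeight hv0 hσ, hσ _ (by simp), hσ (a + (Fin.last n : ℕ)) (by simp)]
    simp [vacuum, add_assoc]
  refine (tsum_eq_tsum_of_ne_zero_bij (fun σ (i : Fin (n + 1)) => σ.1.lam (a + (i : ℕ))) ?_ ?_ ?_).symm
  · intro σ τ h
    refine Subtype.ext (SchurSeq.ext_lam fun X => ?_)
    by_cases hX : X ≤ a ∨ a + n ≤ X
    · rw [hempty σ hX, hempty τ hX]
    · have := congrFun h ⟨(X - a).toNat, by omega⟩
      simp only at this
      rwa [show a + ((X - a).toNat : ℤ) = X by omega] at this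
  · intro p hp
    have hp' := hp
    rw [Function.mem_support, mul_ne_zero_iff, mul_ne_zero_iff, Finset.prod_ne_zero_iff] at hp
    obtain ⟨⟨h0, hK⟩, hn⟩ := hp
    have h0 : p 0 = emptyPartition := by
      by_contra h
      exact h0 (if_neg h)
    have hn : p (Fin.last n) = emptyPartition := by
      by_contra h
      exact hn (if_neg h)
    have hstep (i : Fin n) : stepRel (a + (i : ℕ)) (p i.castSucc) (p i.succ) := by
      have := hK i (Finset.mem_univ _)
      rw [stepKernel_eq] at this
      by_contra h
      exact this (if_neg h)
    let σ : SchurSeq := ⟨extendPath a p, (Set.finite_Icc a (a + n)).subset fun X hX => by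
        by_contra h
        rw [Set.mem_Icc] at h
        exact hX (extendPath_eq_empty h0 hn (by omega)),
      (forall_stepRel_iff _).1 (stepRel_extendPath h0 hn hstep)⟩
    have hσ (i : Fin (n + 1)) : σ.lam (a + (i : ℕ)) = p i := extendPath_add a p i
    have := hval σ fun X hX => extendPath_eq_empty h0 hn hX
    simp only [hσ] at this
    refine ⟨⟨σ, ?_⟩, funext hσ⟩
    rw [Function.mem_support, ← this]
    exact hp'
  · intro σ
    exact hval σ.1 fun X hX => hempty σ hX

/-! ### The product formula -/

/-- Real version of `pairFactor`, equal to `1` unless `X` is an addition step and `Y` a removal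
step. -/
noncomputable def realFactor (v : ℤ → ℝ) (X Y : ℤ) : ℝ :=
  if X % 4 < 2 ∧ 2 ≤ Y % 4 then
    if (X % 4 = 0 ∨ X % 4 = 2) ↔ (Y % 4 = 0 ∨ Y % 4 = 2) then (1 - v X * v Y)⁻¹ else 1 + v X * v Y
  else 1

theorem ofReal_realFactor {v : ℤ → ℝ} (hv : ∀ X, 0 ≤ v X ∧ v X < 1) (X Y : ℤ) :
    (if X % 4 < 2 ∧ 2 ≤ Y % 4 then pairFactor (fun X => ENNReal.ofReal (v X)) X Y else 1) =
      ENNReal.ofReal (realFactor v X Y) := by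
  have h0 : 0 ≤ v X * v Y := mul_nonneg (hv X).1 (hv Y).1
  have h1 : v X * v Y < 1 := mul_lt_one_of_nonneg_of_lt_one_left (hv X).1 (hv X).2 (hv Y).2.le
  unfold realFactor pairFactor
  split_ifs
  · rw [ENNReal.ofReal_inv_of_pos (by linarith), ENNReal.ofReal_sub _ h0, ENNReal.ofReal_one,
      ENNReal.ofReal_mul (hv X).1]
  · rw [ENNReal.ofReal_add zero_le_one h0, ENNReal.ofReal_one, ENNReal.ofReal_mul (hv X).1]
  · rw [ENNReal.ofReal_one]

theorem realFactor_nonneg {v : ℤ → ℝ} (hv : ∀ X, 0 ≤ v X ∧ v X < 1) (X Y : ℤ) :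
    0 ≤ realFactor v X Y := by
  have h0 : 0 ≤ v X * v Y := mul_nonneg (hv X).1 (hv Y).1
  have h1 : v X * v Y < 1 := mul_lt_one_of_nonneg_of_lt_one_left (hv X).1 (hv X).2 (hv Y).2.le
  unfold realFactor
  split_ifs
  · exact inv_nonneg.2 (by linarith)
  · linarith
  · exact zero_le_one

theorem prod_range_four_mul {M : Type*} [CommMonoid M] (f : ℕ → M) (n : ℕ) :
    ∏ m ∈ Finset.range (4 * n), f m =
      ∏ k ∈ Finset.range n, f (4 * k) * f (4 * k + 1) * f (4 * k + 2) * f (4 * k + 3) := by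
  induction n with
  | zero => simp
  | succ n ih =>
    rw [Finset.prod_range_succ _ n, ← ih, show 4 * (n + 1) = 4 * n + 1 + 1 + 1 + 1 by ring]
    simp only [Finset.prod_range_succ, mul_assoc]

theorem steep_factor_eq (v : ℤ → ℝ) (i j : ℤ) :
    (1 + v (4 * i) * v (4 * j - 1)) * (1 + v (4 * i + 1) * v (4 * j - 2)) /
      ((1 - v (4 * i) * v (4 * j - 2)) * (1 - v (4 * i + 1) * v (4 * j - 1))) =
    (realFactor v (4 * i) (4 * j - 2) * realFactor v (4 * i + 1) (4 * j - 2)) *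
      (realFactor v (4 * i) (4 * j - 1) * realFactor v (4 * i + 1) (4 * j - 1)) := by
  have e0 : (4 * i) % 4 = 0 := by omega
  have e1 : (4 * i + 1) % 4 = 1 := by omega
  have e2 : (4 * j - 2) % 4 = 2 := by omega
  have e3 : (4 * j - 1) % 4 = 3 := by omega
  simp only [realFactor, e0, e1, e2, e3]
  norm_num
  rw [div_eq_mul_inv, mul_inv]
  ring

theorem prod_realFactor (v : ℤ → ℝ) (b : ℤ) (n : ℕ) :
    (∏ m ∈ Finset.range (4 * n), ∏ i ∈ Finset.range m, realFactor v (4 * b + i) (4 * b + m)) =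
      ∏ k ∈ Finset.range n, ∏ i ∈ Finset.range (k + 1),
        (realFactor v (4 * (b + i)) (4 * (b + k + 1) - 2) *
          realFactor v (4 * (b + i) + 1) (4 * (b + k + 1) - 2)) *
        (realFactor v (4 * (b + i)) (4 * (b + k + 1) - 1) *
          realFactor v (4 * (b + i) + 1) (4 * (b + k + 1) - 1)) := by
  have hY (X Y : ℤ) (h : Y % 4 < 2) : realFactor v X Y = 1 := if_neg (by omega)
  have hX (X Y : ℤ) (h : 2 ≤ X % 4) : realFactor v X Y = 1 := if_neg (by omega)
  have inner (k : ℕ) (Y : ℤ) : ∏ i ∈ Finset.range (4 * k + 2), realFactor v (4 * b + i) Y =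
      ∏ i ∈ Finset.range (k + 1),
        realFactor v (4 * (b + i)) Y * realFactor v (4 * (b + i) + 1) Y := by
    rw [Finset.prod_range_succ, Finset.prod_range_succ, prod_range_four_mul,
      Finset.prod_range_succ, mul_assoc]
    congr 1
    · refine Finset.prod_congr rfl fun i _ => ?_
      rw [hX (4 * b + ((4 * i + 2 : ℕ) : ℤ)) _ (by push_cast; omega),
        hX (4 * b + ((4 * i + 3 : ℕ) : ℤ)) _ (by push_cast; omega), mul_one, mul_one]
      congr 2 <;> push_cast <;> ring
    · congr 2 <;> push_cast <;> ring
  rw [prod_range_four_mul]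
  refine Finset.prod_congr rfl fun k _ => ?_
  rw [Finset.prod_mul_distrib, ← inner, ← inner,
    Finset.prod_eq_one fun i _ => hY _ _ (by push_cast; omega),
    Finset.prod_eq_one fun i _ => hY _ _ (by push_cast; omega), one_mul, one_mul,
    Finset.prod_range_succ _ (4 * k + 2), hX _ _ (by push_cast; omega), mul_one]
  congr 1 <;> refine Finset.prod_congr rfl fun i _ => ?_ <;> congr 1 <;> push_cast <;> ring

theorem exists_vanishing_bound {v : ℤ → ℝ} (hfin : (Function.support v).Finite) :
    ∃ M : ℕ, ∀ X : ℤ, X < 4 * (-M : ℤ) ∨ 4 * (-M : ℤ) + (4 * (2 * M) : ℕ) ≤ X → v X = 0 := by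
  obtain ⟨B, hB⟩ := (hfin.image fun X => X.natAbs).bddAbove
  refine ⟨B + 1, fun X hX => ?_⟩
  by_contra h
  have := hB (Set.mem_image_of_mem _ (show X ∈ Function.support v from h))
  push_cast at hX
  omega

theorem steep_tilings_partition_function (v : ℤ → ℝ)
    (hv : ∀ X : ℤ, 0 ≤ v X ∧ v X < 1) (hfin : (Function.support v).Finite) :
    Summable (steepWeight v) ∧
    (Function.mulSupport (fun p : ℤ × ℤ =>
        if p.1 < p.2 then
          (1 + v (4 * p.1) * v (4 * p.2 - 1)) * (1 + v (4 * p.1 + 1) * v (4 * p.2 - 2)) /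
            ((1 - v (4 * p.1) * v (4 * p.2 - 2)) * (1 - v (4 * p.1 + 1) * v (4 * p.2 - 1)))
        else 1)).Finite ∧
    (∑' σ : SchurSeq, steepWeight v σ) =
      ∏ᶠ p : ℤ × ℤ,
        (if p.1 < p.2 then
          (1 + v (4 * p.1) * v (4 * p.2 - 1)) * (1 + v (4 * p.1 + 1) * v (4 * p.2 - 2)) /
            ((1 - v (4 * p.1) * v (4 * p.2 - 2)) * (1 - v (4 * p.1 + 1) * v (4 * p.2 - 1)))
        else 1) := by
  obtain ⟨M, hM⟩ := exists_vanishing_bound hfin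
  have hsum := tsum_ofReal_steepWeight (fun X => (hv X).1) hM
  simp only [state_eq, growthState_empty, mul_one, ofReal_realFactor hv] at hsum
  have hnn (m : ℕ) : 0 ≤ ∏ i ∈ Finset.range m,
      realFactor v (4 * (-M : ℤ) + i) (4 * (-M : ℤ) + m) :=
    Finset.prod_nonneg fun i _ => realFactor_nonneg hv _ _
  rw [Finset.prod_congr rfl fun m _ => (ENNReal.ofReal_prod_of_nonneg fun i _ =>
      realFactor_nonneg hv _ _).symm, ← ENNReal.ofReal_prod_of_nonneg fun m _ => hnn m] at hsum
  have hw (σ : SchurSeq) : (ENNReal.ofReal (steepWeight v σ)).toReal = steepWeight v σ :=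
    ENNReal.toReal_ofReal (finprod_nonneg fun X => pow_nonneg (hv X).1 _)
  have htsum : ∑' σ, steepWeight v σ = ∏ m ∈ Finset.range (4 * (2 * M)), ∏ i ∈ Finset.range m,
      realFactor v (4 * (-M : ℤ) + i) (4 * (-M : ℤ) + m) := by
    rw [← ENNReal.toReal_ofReal (Finset.prod_nonneg fun m _ => hnn m), ← hsum,
      ENNReal.tsum_toReal_eq fun _ => ENNReal.ofReal_ne_top]
    simp only [hw]
  have hsub : (Function.mulSupport (fun p : ℤ × ℤ =>
        if p.1 < p.2 then
          (1 + v (4 * p.1) * v (4 * p.2 - 1)) * (1 + v (4 * p.1 + 1) * v (4 * p.2 - 2)) /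
            ((1 - v (4 * p.1) * v (4 * p.2 - 2)) * (1 - v (4 * p.1 + 1) * v (4 * p.2 - 1)))
        else 1)) ⊆ (((Finset.range (2 * M)).sigma fun k => Finset.range (k + 1)).image
          fun q : (_ : ℕ) × ℕ => ((-M + q.2, -M + q.1 + 1) : ℤ × ℤ) : Finset (ℤ × ℤ)) := by
    rintro ⟨i, j⟩ hp
    by_contra h
    refine hp ?_
    simp only
    split_ifs with hij
    · have hout : i < -M ∨ M < j := by
        by_contra! hout
        refine h ?_
        simp only [Finset.coe_image, Set.mem_image, Finset.mem_coe, Finset.mem_sigma,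
          Finset.mem_range, Prod.mk.injEq]
        exact ⟨⟨(j - 1 + M).toNat, (i + M).toNat⟩, by simp only; omega, by simp only; omega⟩
      rcases hout with hi | hj
      · rw [hM (4 * i) (by omega), hM (4 * i + 1) (by omega)]
        simp
      · rw [hM (4 * j - 1) (by omega), hM (4 * j - 2) (by omega)]
        simp
    · rfl
  refine ⟨?_, (Finset.finite_toSet _).subset hsub, ?_⟩
  · have := ENNReal.summable_toReal (hsum.trans_ne ENNReal.ofReal_ne_top)
    simpa only [hw] using this
  · rw [htsum, prod_realFactor, finprod_eq_prod_of_mulSupport_subset _ hsub, Finset.prod_image,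
      Finset.prod_sigma]
    · refine Finset.prod_congr rfl fun k _ => Finset.prod_congr rfl fun i hi => ?_
      rw [Finset.mem_range] at hi
      rw [if_pos (by simp only; omega), steep_factor_eq]
    · rintro ⟨k, i⟩ _ ⟨k', i'⟩ _ h
      simp only [Prod.mk.injEq] at h
      obtain ⟨rfl, rfl⟩ : k = k' ∧ i = i' := by omega
      rfl
end
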